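/- The sprite transformation t, viewed as a map from the set of all frames onto its range {t(F) | F a frame}, is a bijection; that is, t is injective on the universe of frames and every element of the range of t is attained, so the corestriction of t to its range is bijective. (The paper's Lemma 1: the state transformation function t is a bijection.) -/

import Mathlib

/-- A pixel: x-coordinate, y-coordinate, color. -/
abbrev Pixel (C : Type*) := ℤ × ℤ × C

/-- The color of a pixel is its third coordinate. -/
def pixelColor {C : Type*} (p : Pixel C) : C := p.2.2

/-- Two pixels are grid-adjacent if they are at Manhattan distance one. -/
def GridAdjacent {C : Type*} (p q : Pixel C) : Prop :=
  |p.1 - q.1| + |p.2.1 - q.2.1| = 1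

/-- The step relation: p and q are in the frame, grid-adjacent, and have the same color. -/
def step {C : Type*} (F : Set (Pixel C)) (p q : Pixel C) : Prop :=
  p ∈ F ∧ q ∈ F ∧ GridAdjacent p q ∧ pixelColor p = pixelColor q

/-- The connectivity relation: reflexive-transitive closure of the step relation. -/
def conn {C : Type*} (F : Set (Pixel C)) : Pixel C → Pixel C → Prop :=
  Relation.ReflTransGen (step F)

/-- The sprite of a pixel p in a frame F. -/
def sprite {C : Type*} (F : Set (Pixel C)) (p : Pixel C) : Set (Pixel C) :=
  {q | conn F p q}

/-- The sprite transformation t : frames → sets of sprites. -/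
def spriteTransform {C : Type*} (F : Set (Pixel C)) : Set (Set (Pixel C)) :=
  {o | ∃ p ∈ F, o = sprite F p}

theorem mem_of_conn {C : Type*} {F : Set (Pixel C)} {p q : Pixel C} (hp : p ∈ F)
    (h : conn F p q) : q ∈ F := by
  obtain rfl | ⟨_, _, hs⟩ := Relation.ReflTransGen.cases_tail_iff _ _ _ |>.mp h
  · exact hp
  · exact hs.2.1

/-- A frame is recovered as the union of its sprites. -/
theorem sUnion_spriteTransform {C : Type*} (F : Set (Pixel C)) :
    ⋃₀ spriteTransform F = F := by
  ext q
  constructor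
  · rintro ⟨_, ⟨p, hp, rfl⟩, hq⟩
    exact mem_of_conn hp hq
  · intro hq
    exact ⟨sprite F q, ⟨q, hq, rfl⟩, Relation.ReflTransGen.refl⟩

theorem spriteTransform_injective {C : Type*} :
    Function.Injective (spriteTransform (C := C)) :=
  Function.LeftInverse.injective sUnion_spriteTransform

/-- t, corestricted onto its range, is a bijection. -/
theorem spriteTransform_bijective_onto_range {C : Type*} :
    Function.Bijective
      (Set.rangeFactorization (spriteTransform (C := C))) :=
  ⟨Set.rangeFactorization_injective.mpr spriteTransform_injective,
    Set.rangeFactorization_surjective⟩
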